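/- Let k be a field and let C be a k-linear abelian category in which every object has finite length and in which Ext¹_C(Y, X) is a finite-dimensional k-vector space for all objects X, Y. Let F : C ≌ C be a k-linear self-equivalence of C. If an object M of C is a subquotient of an object Ñ with F(Ñ) ≅ Ñ, then there exist an object N of C with F(N) ≅ N and a monomorphism M ↪ N. -/

import Mathlib

open CategoryTheory Limits CategoryTheory.Abelian

universe w v u t

namespace CategoryTheory.Abelian.Ext

variable {C : Type u} [Category.{v} C] [Abelian C] [HasExt.{w} C]
variable {k : Type t} [Field k] [Linear k C]

lemma mk₀_add' {X Y : C} (f g : X ⟶ Y) : mk₀ (f + g) = mk₀ f + mk₀ g := by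
  letI := HasDerivedCategory.standard C
  apply Ext.ext
  simp only [mk₀_hom, Functor.map_add, add_hom]
  simp [ShiftedHom.mk₀, Preadditive.add_comp]

/-- The canonical scalar multiplication on `Ext`-groups of a `k`-linear abelian category:
`c • ε` is the push-forward of `ε` along `c • 𝟙`. -/
noncomputable instance extSMul {X Y : C} {n : ℕ} : SMul k (Ext X Y n) :=
  ⟨fun c ε => ε.comp (mk₀ (c • 𝟙 Y)) (add_zero n)⟩

lemma smul_def {X Y : C} {n : ℕ} (c : k) (ε : Ext X Y n) :
    c • ε = ε.comp (mk₀ (c • 𝟙 Y)) (add_zero n) := rfl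

/-- The canonical `k`-vector space structure on `Ext`-groups of a `k`-linear
abelian category. -/
noncomputable instance extModule {X Y : C} {n : ℕ} : Module k (Ext X Y n) where
  one_smul ε := by rw [smul_def, one_smul, comp_mk₀_id]
  mul_smul a b ε := by
    rw [smul_def, smul_def, smul_def, comp_assoc_of_third_deg_zero, mk₀_comp_mk₀]
    congr 2
    rw [Linear.smul_comp, Linear.comp_smul, Category.comp_id, smul_smul, mul_comm]
  smul_zero a := by rw [smul_def, zero_comp]
  smul_add a ε₁ ε₂ := by rw [smul_def, smul_def, smul_def, add_comp]
  add_smul a b ε := by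
    rw [smul_def, smul_def, smul_def, add_smul, mk₀_add', comp_add]
  zero_smul ε := by rw [smul_def, zero_smul, mk₀_zero, comp_zero]

end CategoryTheory.Abelian.Ext

variable {C : Type u} [Category.{v} C] [Abelian C]

/-- The `n`-fold iterate of an endofunctor. -/
def funcPow (F : C ⥤ C) : ℕ → C ⥤ C
  | 0 => 𝟭 C
  | n + 1 => funcPow F n ⋙ F

/-- `S` is a subquotient of `M` if there are an object `X`, a monomorphism `X ↪ M` and an
epimorphism `X ↠ S`. -/
def IsSubquotient (S M : C) : Prop :=
  ∃ (X : C) (f : X ⟶ M) (g : X ⟶ S), Mono f ∧ Epi g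

/-- An object `M` has finite length if there is a finite chain of monomorphisms
`0 = X₀ ↪ X₁ ↪ ⋯ ↪ X_m = M` all of whose successive quotients are simple. -/
def HasFiniteLength (M : C) : Prop :=
  ∃ (m : ℕ) (X : Fin (m + 1) → C) (f : ∀ i : Fin m, X i.castSucc ⟶ X i.succ),
    IsZero (X 0) ∧ (∀ i : Fin m, Mono (f i) ∧ Simple (cokernel (f i))) ∧
      Nonempty (X (Fin.last m) ≅ M)

namespace CategoryTheory.Abelian.Ext

section YonedaClass

variable [HasExt.{w} C]

/-- A class in `Ext¹` is a Yoneda class if it is the class of a short exact sequence. -/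
def IsYonedaClass {X Y : C} (e : Ext.{w} X Y 1) : Prop :=
  ∃ (Z : C) (f : Y ⟶ Z) (g : Z ⟶ X) (zero : f ≫ g = 0)
    (h : (ShortComplex.mk f g zero).ShortExact), h.extClass = e

lemma isYonedaClass_extClass {S : ShortComplex C} (hS : S.ShortExact) :
    IsYonedaClass (hS.extClass : Ext.{w} S.X₃ S.X₁ 1) :=
  ⟨S.X₂, S.f, S.g, S.zero, hS, rfl⟩

/-- Pulling back a short exact sequence. -/
lemma IsYonedaClass.precomp {X X' Y : C} {e : Ext.{w} X Y 1} (he : IsYonedaClass e)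
    (v : X' ⟶ X) : IsYonedaClass ((mk₀ v).comp e (zero_add 1)) := by
  obtain ⟨Z, f, g, zero, h, rfl⟩ := he
  have := h.mono_f
  have := h.epi_g
  dsimp at *
  have w : pullback.lift f (0 : Y ⟶ X') (by simp [zero]) ≫ pullback.snd g v = 0 := by
    simp [pullback.lift_snd]
  have hmono : Mono (pullback.lift f (0 : Y ⟶ X') (by simp [zero] : f ≫ g = 0 ≫ v)) :=
    mono_of_mono_fac (pullback.lift_fst _ _ _)
  have h' : (ShortComplex.mk _ _ w).ShortExact := by
    refine .mk' (ShortComplex.exact_of_f_is_kernel _ ?_) hmono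
      (inferInstanceAs (Epi (pullback.snd g v)))
    refine KernelFork.IsLimit.ofι' _ _ fun {A} k hk => ?_
    have hk' : (k ≫ pullback.fst g v) ≫ g = 0 := by
      rw [Category.assoc, pullback.condition, reassoc_of% hk, Limits.zero_comp]
    refine ⟨h.exact.lift (k ≫ pullback.fst g v) hk', ?_⟩
    apply pullback.hom_ext
    · simpa [pullback.lift_fst] using h.exact.lift_f (k ≫ pullback.fst g v) hk'
    · simpa [pullback.lift_snd] using hk.symm
  let φ : ShortComplex.mk _ _ w ⟶ ShortComplex.mk f g zero :=
    { τ₁ := 𝟙 _, τ₂ := pullback.fst _ _, τ₃ := v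
      comm₁₂ := by simp [pullback.lift_fst]
      comm₂₃ := pullback.condition }
  have := ShortComplex.ShortExact.extClass_naturality h' h φ
  refine ⟨_, _, _, w, h', ?_⟩
  rw [← this]
  exact (comp_mk₀_id _).symm

/-- Pushing out a short exact sequence. -/
lemma IsYonedaClass.postcomp {X Y Y' : C} {e : Ext.{w} X Y 1} (he : IsYonedaClass e)
    (u : Y ⟶ Y') : IsYonedaClass (e.comp (mk₀ u) (add_zero 1)) := by
  obtain ⟨Z, f, g, zero, h, rfl⟩ := he
  have := h.mono_f
  have := h.epi_g
  dsimp at *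
  have w : pushout.inr f u ≫ pushout.desc g (0 : Y' ⟶ X) (by simp [zero]) = 0 := by
    simp [pushout.inr_desc]
  have hepi : Epi (pushout.desc g (0 : Y' ⟶ X) (by simp [zero] : f ≫ g = u ≫ 0)) :=
    epi_of_epi_fac (pushout.inl_desc _ _ _)
  have h' : (ShortComplex.mk _ _ w).ShortExact := by
    refine .mk' (ShortComplex.exact_of_g_is_cokernel _ ?_)
      (inferInstanceAs (Mono (pushout.inr f u))) hepi
    refine CokernelCofork.IsColimit.ofπ' _ _ fun {A} k hk => ?_
    have hk' : f ≫ pushout.inl f u ≫ k = 0 := by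
      rw [pushout.condition_assoc, hk, Limits.comp_zero]
    refine ⟨h.exact.desc (pushout.inl f u ≫ k) hk', ?_⟩
    apply pushout.hom_ext
    · simpa [pushout.inl_desc_assoc] using h.exact.g_desc (pushout.inl f u ≫ k) hk'
    · simpa [pushout.inr_desc_assoc] using hk.symm
  let φ : ShortComplex.mk f g zero ⟶ ShortComplex.mk _ _ w :=
    { τ₁ := u, τ₂ := pushout.inl _ _, τ₃ := 𝟙 _
      comm₁₂ := pushout.condition.symm
      comm₂₃ := by simp [pushout.inl_desc] }
  have := ShortComplex.ShortExact.extClass_naturality h h' φ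
  exact ⟨_, _, _, w, h', by rw [this]; exact (mk₀_id_comp _).symm⟩

/-- The amalgamated sum of two extensions of `X₁` and `X₂` by `Y` is an extension
of `X₁ ⊞ X₂` by `Y`. -/
lemma IsYonedaClass.exists_biprod {X₁ X₂ Y : C} {e₁ : Ext.{w} X₁ Y 1} {e₂ : Ext.{w} X₂ Y 1}
    (he₁ : IsYonedaClass e₁) (he₂ : IsYonedaClass e₂) :
    ∃ e : Ext.{w} (X₁ ⊞ X₂) Y 1, IsYonedaClass e ∧
      (mk₀ biprod.inl).comp e (zero_add 1) = e₁ ∧ (mk₀ biprod.inr).comp e (zero_add 1) = e₂ := by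
  obtain ⟨Z₁, f₁, g₁, zero₁, h₁, rfl⟩ := he₁
  obtain ⟨Z₂, f₂, g₂, zero₂, h₂, rfl⟩ := he₂
  have := h₁.mono_f
  have := h₁.epi_g
  have := h₂.mono_f
  have := h₂.epi_g
  dsimp at *
  let q : pushout f₁ f₂ ⟶ X₁ ⊞ X₂ := pushout.desc (g₁ ≫ biprod.inl) (g₂ ≫ biprod.inr)
    (by simp [reassoc_of% zero₁, reassoc_of% zero₂])
  have w : (f₁ ≫ pushout.inl f₁ f₂) ≫ q = 0 := by simp [q, pushout.inl_desc, reassoc_of% zero₁]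
  have hepi : Epi q := by
    refine Preadditive.epi_of_cancel_zero _ fun {A} k hk => ?_
    have h1 : g₁ ≫ biprod.inl ≫ k = 0 := by
      simpa [q, pushout.inl_desc_assoc] using pushout.inl f₁ f₂ ≫= hk
    have h2 : g₂ ≫ biprod.inr ≫ k = 0 := by
      simpa [q, pushout.inr_desc_assoc] using pushout.inr f₁ f₂ ≫= hk
    apply biprod.hom_ext'
    · rw [← cancel_epi g₁, h1, Limits.comp_zero, Limits.comp_zero]
    · rw [← cancel_epi g₂, h2, Limits.comp_zero, Limits.comp_zero]
  have h : (ShortComplex.mk _ _ w).ShortExact := by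
    refine .mk' (ShortComplex.exact_of_g_is_cokernel _ ?_)
      (inferInstanceAs (Mono (f₁ ≫ pushout.inl f₁ f₂))) hepi
    refine CokernelCofork.IsColimit.ofπ' _ _ fun {A} k hk => ?_
    have hk₁ : f₁ ≫ pushout.inl f₁ f₂ ≫ k = 0 := by simpa using hk
    have hk₂ : f₂ ≫ pushout.inr f₁ f₂ ≫ k = 0 := by rw [← pushout.condition_assoc, hk₁]
    refine ⟨biprod.desc (h₁.exact.desc _ hk₁) (h₂.exact.desc _ hk₂), ?_⟩
    apply pushout.hom_ext
    · simpa [q, pushout.inl_desc_assoc] using h₁.exact.g_desc _ hk₁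
    · simpa [q, pushout.inr_desc_assoc] using h₂.exact.g_desc _ hk₂
  let φ₁ : ShortComplex.mk f₁ g₁ zero₁ ⟶ ShortComplex.mk _ _ w :=
    { τ₁ := 𝟙 _, τ₂ := pushout.inl _ _, τ₃ := biprod.inl
      comm₂₃ := by simp [q, pushout.inl_desc] }
  let φ₂ : ShortComplex.mk f₂ g₂ zero₂ ⟶ ShortComplex.mk _ _ w :=
    { τ₁ := 𝟙 _, τ₂ := pushout.inr _ _, τ₃ := biprod.inr
      comm₁₂ := by simp [pushout.condition]
      comm₂₃ := by simp [q, pushout.inr_desc] }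
  refine ⟨h.extClass, isYonedaClass_extClass h, ?_, ?_⟩
  · exact (ShortComplex.ShortExact.extClass_naturality h₁ h φ₁).symm.trans (comp_mk₀_id _)
  · exact (ShortComplex.ShortExact.extClass_naturality h₂ h φ₂).symm.trans (comp_mk₀_id _)

lemma IsYonedaClass.add {X Y : C} {e₁ e₂ : Ext.{w} X Y 1}
    (he₁ : IsYonedaClass e₁) (he₂ : IsYonedaClass e₂) : IsYonedaClass (e₁ + e₂) := by
  obtain ⟨e, he, rfl, rfl⟩ := he₁.exists_biprod he₂
  rw [← add_comp, ← mk₀_add]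
  exact he.precomp _

lemma isYonedaClass_zero (X Y : C) : IsYonedaClass (0 : Ext.{w} X Y 1) := by
  have h : (ShortComplex.mk (biprod.inl : Y ⟶ Y ⊞ X) biprod.snd (by simp)).ShortExact :=
    (ShortComplex.Splitting.ofHasBinaryBiproduct Y X).shortExact
  have := (isYonedaClass_extClass.{w} h).precomp (0 : X ⟶ X)
  rwa [mk₀_zero, zero_comp] at this

end YonedaClass

section Linear

variable [HasExt.{w} C] {k : Type t} [Field k] [Linear k C]

lemma mk₀_smul_comp {X X' Y : C} {n : ℕ} (c : k) (f : X' ⟶ X) (e : Ext.{w} X Y n) :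
    (mk₀ (c • f)).comp e (zero_add n) = c • (mk₀ f).comp e (zero_add n) := by
  rw [mk₀_smul, smul_comp, smul_eq_comp_mk₀]
  rfl

lemma mk₀_comp_smul {X X' Y : C} {n : ℕ} (c : k) (f : X' ⟶ X) (e : Ext.{w} X Y n) :
    (mk₀ f).comp (c • e) (zero_add n) = c • (mk₀ f).comp e (zero_add n) := by
  rw [smul_def, smul_def, comp_assoc_of_third_deg_zero]

lemma smul_comp_mk₀ {X Y Y' : C} {n : ℕ} (c : k) (e : Ext.{w} X Y n) (f : Y ⟶ Y') :
    (c • e).comp (mk₀ f) (add_zero n) = c • e.comp (mk₀ f) (add_zero n) := by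
  simp [smul_def]

lemma mapExactFunctor_smul' (F : C ⥤ C) [F.Additive] [F.Linear k] [PreservesFiniteLimits F]
    [PreservesFiniteColimits F] {X Y : C} {n : ℕ} (c : k) (e : Ext.{w} X Y n) :
    (c • e).mapExactFunctor F = c • (e.mapExactFunctor F : Ext.{w} _ _ n) := by
  simp [smul_def, mapExactFunctor_comp, mapExactFunctor_mk₀]

variable (k) in
/-- The subspace of Yoneda classes in `Ext¹`. -/
def yonedaClasses (X Y : C) : Submodule k (Ext.{w} X Y 1) where
  carrier := {e | IsYonedaClass e}
  add_mem' := IsYonedaClass.add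
  zero_mem' := isYonedaClass_zero X Y
  smul_mem' c _ he := he.postcomp (c • 𝟙 Y)

end Linear

end CategoryTheory.Abelian.Ext

namespace CategoryTheory.Limits.biproduct

variable {k : Type t} [Field k] [Linear k C]

attribute [local instance] Abelian.hasFiniteBiproducts

/-- The endomorphism of a power of `T` given by a matrix of scalars. -/
noncomputable def scalarMatrix (T : C) {J : Type} [Fintype J] (m : Matrix J J k) :
    (⨁ fun _ : J => T) ⟶ ⨁ fun _ : J => T :=
  biproduct.matrix fun i j => m i j • 𝟙 T

lemma ι_scalarMatrix (T : C) {J : Type} [Fintype J] (m : Matrix J J k) (i : J) :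
    biproduct.ι (fun _ : J => T) i ≫ scalarMatrix T m = ∑ j, m i j • biproduct.ι _ j := by
  classical
  rw [scalarMatrix, biproduct.ι_matrix, biproduct.lift_eq]
  simp

lemma scalarMatrix_one (T : C) {J : Type} [Fintype J] [DecidableEq J] :
    scalarMatrix T (1 : Matrix J J k) = 𝟙 _ := by
  refine biproduct.hom_ext' _ _ fun i => ?_
  simp [ι_scalarMatrix, Matrix.one_apply, ite_smul]

lemma scalarMatrix_mul (T : C) {J : Type} [Fintype J] (m m' : Matrix J J k) :
    scalarMatrix T m ≫ scalarMatrix T m' = scalarMatrix T (m * m') := by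
  refine biproduct.hom_ext' _ _ fun i => ?_
  rw [reassoc_of% ι_scalarMatrix, Preadditive.sum_comp, ι_scalarMatrix]
  simp only [Linear.smul_comp, ι_scalarMatrix, Finset.smul_sum, smul_smul, Matrix.mul_apply,
    Finset.sum_smul]
  exact Finset.sum_comm

end CategoryTheory.Limits.biproduct

namespace CategoryTheory.ShortComplex.ShortExact

open Abelian

variable [HasExt.{w} C] {S S₁ S₂ : ShortComplex C}

lemma exists_comp_eq_of_extClass_comp_eq_zero (hS : S.ShortExact) {Y : C} (u : S.X₁ ⟶ Y)
    (hu : (hS.extClass : Ext.{w} _ _ 1).comp (Ext.mk₀ u) (add_zero 1) = 0) :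
    ∃ φ : S.X₂ ⟶ Y, S.f ≫ φ = u := by
  obtain ⟨x, hx⟩ := Ext.contravariant_sequence_exact₁ hS (Y := Y) (Ext.mk₀ u) (add_zero 1) hu
  obtain ⟨φ, rfl⟩ := (Ext.mk₀_bijective _ _).2 x
  exact ⟨φ, (Ext.mk₀_bijective _ _).1 (by simpa using hx)⟩

lemma exists_comp_eq_of_comp_extClass_eq_zero (hS : S.ShortExact) {X : C} (v : X ⟶ S.X₃)
    (hv : (Ext.mk₀ v).comp (hS.extClass : Ext.{w} _ _ 1) (zero_add 1) = 0) :
    ∃ s : X ⟶ S.X₂, s ≫ S.g = v := by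
  obtain ⟨x, hx⟩ := Ext.covariant_sequence_exact₃ (X := X) hS (Ext.mk₀ v) (zero_add 1) hv
  obtain ⟨s, rfl⟩ := (Ext.mk₀_bijective _ _).2 x
  exact ⟨s, (Ext.mk₀_bijective _ _).1 (by simpa using hx)⟩

/-- Two short exact sequences whose classes correspond under isomorphisms of their outer terms
have isomorphic middle terms. -/
lemma nonempty_iso_of_extClass_comp_eq (h₁ : S₁.ShortExact) (h₂ : S₂.ShortExact)
    (u : S₁.X₁ ≅ S₂.X₁) (v : S₁.X₃ ≅ S₂.X₃)
    (huv : (h₁.extClass : Ext.{w} _ _ 1).comp (Ext.mk₀ u.hom) (add_zero 1) =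
      (Ext.mk₀ v.hom).comp h₂.extClass (zero_add 1)) : Nonempty (S₁.X₂ ≅ S₂.X₂) := by
  obtain ⟨φ, hφ⟩ := h₁.exists_comp_eq_of_extClass_comp_eq_zero (u.hom ≫ S₂.f) <| by
    rw [← Ext.mk₀_comp_mk₀, ← Ext.comp_assoc_of_third_deg_zero, huv,
      Ext.comp_assoc_of_third_deg_zero, extClass_comp, Ext.comp_zero]
  have := h₁.epi_g
  have hφ' : S₁.f ≫ φ ≫ S₂.g = 0 := by rw [reassoc_of% hφ, S₂.zero, comp_zero]
  let ψ : S₁ ⟶ S₂ :=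
    { τ₁ := u.hom, τ₂ := φ, τ₃ := h₁.exact.desc _ hφ'
      comm₁₂ := hφ.symm, comm₂₃ := (h₁.exact.g_desc _ hφ').symm }
  obtain ⟨s, hs⟩ := h₂.exists_comp_eq_of_comp_extClass_eq_zero (v.hom - ψ.τ₃) <| by
    rw [sub_eq_add_neg, Ext.mk₀_add, Ext.add_comp, Ext.mk₀_neg, Ext.neg_comp,
      ← extClass_naturality h₁ h₂ ψ, ← huv]
    exact add_neg_cancel _
  let χ : S₁ ⟶ S₂ :=
    { τ₁ := u.hom, τ₂ := φ + S₁.g ≫ s, τ₃ := v.hom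
      comm₁₂ := by simp [hφ]
      comm₂₃ := by simp [hs, ← ψ.comm₂₃, show φ ≫ S₂.g = S₁.g ≫ ψ.τ₃ from ψ.comm₂₃] }
  have : IsIso χ.τ₁ := inferInstanceAs (IsIso u.hom)
  have : IsIso χ.τ₃ := inferInstanceAs (IsIso v.hom)
  have := isIso₂_of_shortExact_of_isIso₁₃ χ h₁ h₂
  exact ⟨asIso χ.τ₂⟩

end CategoryTheory.ShortComplex.ShortExact

namespace CategoryTheory.Abelian.Ext

variable [HasExt.{w} C]

section MapExactFunctor

variable (F : C ⥤ C) [F.Additive] [PreservesFiniteLimits F] [PreservesFiniteColimits F]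

lemma IsYonedaClass.mapExactFunctor {X Y : C} {e : Ext.{w} X Y 1} (he : IsYonedaClass e) :
    IsYonedaClass (e.mapExactFunctor F : Ext.{w} _ _ 1) := by
  obtain ⟨Z, f, g, zero, h, rfl⟩ := he
  rw [mapExactFunctor_extClass]
  exact isYonedaClass_extClass (h.map_of_exact F)

lemma extClass_eq_zero_of_map [F.Full] [F.Faithful] {S : ShortComplex C} (hS : S.ShortExact)
    (h : ((hS.map_of_exact F).extClass : Ext.{w} _ _ 1) = 0) :
    (hS.extClass : Ext.{w} _ _ 1) = 0 := by
  obtain ⟨r, hr⟩ := (hS.map_of_exact F).exists_comp_eq_of_extClass_comp_eq_zero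
    (𝟙 (S.map F).X₁) (by rw [comp_mk₀_id, h])
  obtain ⟨ρ, rfl⟩ := F.map_surjective r
  have hρ : S.f ≫ ρ = 𝟙 S.X₁ := F.map_injective (by simpa using! hr)
  rw [← comp_mk₀_id hS.extClass, ← hρ, ← mk₀_comp_mk₀, hS.extClass_comp_assoc]

lemma IsYonedaClass.eq_zero_of_mapExactFunctor_eq_zero [F.Full] [F.Faithful] {X Y : C}
    {e : Ext.{w} X Y 1} (he : IsYonedaClass e)
    (h : (e.mapExactFunctor F : Ext.{w} _ _ 1) = 0) : e = 0 := by
  obtain ⟨Z, f, g, zero, hS, rfl⟩ := he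
  rw [mapExactFunctor_extClass] at h
  exact extClass_eq_zero_of_map F hS h

end MapExactFunctor

attribute [local instance] Abelian.hasFiniteBiproducts

lemma hom_ext_biproduct {J : Type} [Fintype J] {X : J → C} {Y : C} {n : ℕ}
    {e e' : Ext.{w} (⨁ X) Y n}
    (h : ∀ j, (mk₀ (biproduct.ι X j)).comp e (zero_add n) =
      (mk₀ (biproduct.ι X j)).comp e' (zero_add n)) : e = e' := by
  have key (x : Ext.{w} (⨁ X) Y n) : x = ∑ j, (mk₀ (biproduct.π X j)).comp
      ((mk₀ (biproduct.ι X j)).comp x (zero_add n)) (zero_add n) := by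
    conv_lhs => rw [← mk₀_id_comp x, ← biproduct.total, mk₀_sum, sum_comp]
    simp
  rw [key e, key e']
  simp [h]

/-- There is an extension of a finite biproduct by `Y` whose restrictions to the summands form a
prescribed finite family of Yoneda classes. -/
lemma exists_isYonedaClass_biproduct {J : Type} [Fintype J] {X : J → C} {Y : C}
    (b : ∀ j, Ext.{w} (X j) Y 1) (hb : ∀ j, IsYonedaClass (b j)) :
    ∃ e : Ext.{w} (⨁ X) Y 1, IsYonedaClass e ∧
      ∀ j, (mk₀ (biproduct.ι X j)).comp e (zero_add 1) = b j := by
  classical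
  refine ⟨∑ j, (mk₀ (biproduct.π X j)).comp (b j) (zero_add 1), ?_, fun i => ?_⟩
  · exact Finset.sum_induction _ IsYonedaClass (fun _ _ => .add) (isYonedaClass_zero _ _)
      fun j _ => (hb j).precomp _
  · rw [comp_sum, Finset.sum_eq_single i]
    · simp
    · intro j _ hj
      rw [mk₀_comp_mk₀_assoc, biproduct.ι_π_ne _ hj.symm, mk₀_zero, zero_comp]
    · simp

variable {k : Type t} [Field k] [Linear k C]

lemma ι_comp_scalarMatrix_comp {T Y : C} {J : Type} [Fintype J] (m : Matrix J J k) (i : J)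
    {n : ℕ} (e : Ext.{w} (⨁ fun _ : J => T) Y n) :
    (mk₀ (biproduct.ι (fun _ : J => T) i)).comp
      ((mk₀ (biproduct.scalarMatrix T m)).comp e (zero_add n)) (zero_add n) =
        ∑ j, m i j • (mk₀ (biproduct.ι (fun _ : J => T) j)).comp e (zero_add n) := by
  rw [mk₀_comp_mk₀_assoc, biproduct.ι_scalarMatrix, mk₀_sum, sum_comp]
  simp only [mk₀_smul_comp]

variable (F : C ≌ C) [F.functor.Additive] [F.functor.Linear k]

variable (k) in
/-- The action of a linear self-equivalence on the Yoneda classes in `Ext¹(T, N)`, for objects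
`T` and `N` with fixed isomorphisms to their images. -/
noncomputable def yonedaClassesMap {T N : C} (τ : F.functor.obj T ≅ T)
    (α : F.functor.obj N ≅ N) :
    yonedaClasses.{w} k T N →ₗ[k] yonedaClasses.{w} k T N where
  toFun x := ⟨(mk₀ τ.inv).comp ((x.1.mapExactFunctor F.functor : Ext.{w} _ _ 1).comp
    (mk₀ α.hom) (add_zero 1)) (zero_add 1),
    ((IsYonedaClass.mapExactFunctor F.functor x.2).postcomp α.hom).precomp τ.inv⟩
  map_add' x y := Subtype.ext (by simp)
  map_smul' c x := Subtype.ext (by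
    simp only [SetLike.val_smul, mapExactFunctor_smul', smul_comp_mk₀, mk₀_comp_smul,
      RingHom.id_apply])

lemma yonedaClassesMap_injective {T N : C} (τ : F.functor.obj T ≅ T)
    (α : F.functor.obj N ≅ N) : Function.Injective (yonedaClassesMap.{w} k F τ α) := by
  rw [← LinearMap.ker_eq_bot, LinearMap.ker_eq_bot']
  intro x hx
  have hx' : (mk₀ τ.inv).comp ((x.1.mapExactFunctor F.functor : Ext.{w} _ _ 1).comp
    (mk₀ α.hom) (add_zero 1)) (zero_add 1) = 0 := congrArg Subtype.val hx
  refine Subtype.ext (IsYonedaClass.eq_zero_of_mapExactFunctor_eq_zero F.functor x.2 ?_)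
  have := congrArg (fun y => (mk₀ τ.hom).comp (y.comp (mk₀ α.inv) (add_zero 1)) (zero_add 1)) hx'
  simpa using this

/-- The middle term of the universal extension of an invariant object by copies of an invariant
object is invariant. -/
lemma nonempty_iso_of_basis {T N : C} (τ : F.functor.obj T ≅ T) (α : F.functor.obj N ≅ N)
    {n : ℕ} (b : Module.Basis (Fin n) k (yonedaClasses.{w} k T N)) {Z : C} {f : N ⟶ Z}
    {g : Z ⟶ ⨁ fun _ : Fin n => T} {zero : f ≫ g = 0}
    (hS : (ShortComplex.mk f g zero).ShortExact)
    (hb : ∀ i, (mk₀ (biproduct.ι (fun _ : Fin n => T) i)).comp hS.extClass (zero_add 1) =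
      (b i).1) :
    Nonempty (F.functor.obj Z ≅ Z) := by
  have : FiniteDimensional k (yonedaClasses.{w} k T N) := b.finiteDimensional_of_finite
  let Φ := LinearEquiv.ofInjectiveEndo _ (yonedaClassesMap_injective.{w} (k := k) F τ α)
  let A : (⨁ fun _ : Fin n => T) ≅ ⨁ fun _ : Fin n => T :=
    { hom := biproduct.scalarMatrix T (LinearMap.toMatrix b b Φ.toLinearMap).transpose
      inv := biproduct.scalarMatrix T (LinearMap.toMatrix b b Φ.symm.toLinearMap).transpose
      hom_inv_id := by
        rw [biproduct.scalarMatrix_mul, ← Matrix.transpose_mul, ← LinearMap.toMatrix_comp]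
        simp [biproduct.scalarMatrix_one]
      inv_hom_id := by
        rw [biproduct.scalarMatrix_mul, ← Matrix.transpose_mul, ← LinearMap.toMatrix_comp]
        simp [biproduct.scalarMatrix_one] }
  let φ : F.functor.obj (⨁ fun _ : Fin n => T) ≅ ⨁ fun _ : Fin n => T :=
    F.functor.mapBiproduct _ ≪≫ biproduct.mapIso fun _ => τ
  have hφ (i : Fin n) : biproduct.ι (fun _ : Fin n => T) i ≫ φ.inv =
      τ.inv ≫ F.functor.map (biproduct.ι (fun _ : Fin n => T) i) := by
    rw [Iso.comp_inv_eq, Category.assoc, Iso.eq_inv_comp]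
    simp only [φ, Iso.trans_hom, Functor.mapBiproduct_hom]
    refine biproduct.hom_ext _ _ fun j => ?_
    by_cases hij : i = j
    · subst hij
      simp [← Functor.map_comp_assoc]
    · simp [← Functor.map_comp_assoc, biproduct.ι_π_ne _ hij]
  suffices h : (mk₀ φ.inv).comp ((hS.extClass.mapExactFunctor F.functor : Ext.{w}
      (F.functor.obj (⨁ fun _ : Fin n => T)) (F.functor.obj N) 1).comp
      (mk₀ α.hom) (add_zero 1)) (zero_add 1) = (mk₀ A.hom).comp hS.extClass (zero_add 1) by
    refine (hS.map_of_exact F.functor).nonempty_iso_of_extClass_comp_eq.{w} hS α (φ ≪≫ A) ?_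
    have h' := congrArg (fun y => (mk₀ φ.hom).comp y (zero_add 1)) h
    simp only [mk₀_comp_mk₀_assoc, Iso.hom_inv_id, mk₀_id_comp] at h'
    rw [mapExactFunctor_extClass] at h'
    exact h'
  refine hom_ext_biproduct fun i => ?_
  rw [ι_comp_scalarMatrix_comp, mk₀_comp_mk₀_assoc, hφ, ← mk₀_comp_mk₀_assoc]
  simp only [hb]
  have hΦ : (yonedaClassesMap k F τ α (b i)).1 =
      ∑ j, (LinearMap.toMatrix b b Φ.toLinearMap).transpose i j • (b j).1 := by
    have h := congrArg Subtype.val (b.sum_repr (Φ (b i)))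
    rw [AddSubmonoidClass.coe_finsetSum] at h
    simp only [Matrix.transpose_apply, LinearMap.toMatrix_apply]
    exact h.symm
  rw [← hΦ]
  change _ = (mk₀ τ.inv).comp (((b i).1.mapExactFunctor F.functor : Ext.{w} _ _ 1).comp
    (mk₀ α.hom) (add_zero 1)) (zero_add 1)
  rw [← hb, mapExactFunctor_comp, mapExactFunctor_mk₀,
    comp_assoc_of_third_deg_zero]

/-- An invariant object `N` embeds into an invariant object in which all extensions of a given
invariant object by `N` become trivial. -/
lemma exists_mono_forall_comp_eq_zero {T N : C} [FiniteDimensional k (Ext.{w} T N 1)]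
    (hT : Nonempty (F.functor.obj T ≅ T)) (hN : Nonempty (F.functor.obj N ≅ N)) :
    ∃ (Z : C) (f : N ⟶ Z), Mono f ∧ Nonempty (F.functor.obj Z ≅ Z) ∧
      ∀ x : Ext.{w} T N 1, IsYonedaClass x → x.comp (mk₀ f) (add_zero 1) = 0 := by
  obtain ⟨τ⟩ := hT
  obtain ⟨α⟩ := hN
  let b := Module.finBasis k (yonedaClasses.{w} k T N)
  obtain ⟨e, ⟨Z, f, g, zero, hS, rfl⟩, he⟩ :=
    exists_isYonedaClass_biproduct (fun i => (b i).1) fun i => (b i).2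
  refine ⟨Z, f, hS.mono_f, nonempty_iso_of_basis F τ α b hS he, fun x hx => ?_⟩
  have hbf (i) : (b i).1.comp (mk₀ f) (add_zero 1) = 0 := by
    rw [← he i, comp_assoc_of_third_deg_zero, hS.extClass_comp, comp_zero]
  have h := congrArg Subtype.val (b.sum_repr ⟨x, hx⟩)
  simp only [AddSubmonoidClass.coe_finsetSum, SetLike.val_smul] at h
  rw [← h, sum_comp]
  exact Finset.sum_eq_zero fun i _ => by rw [smul_comp_mk₀, hbf, smul_zero]

/-- An extension of a retract of an invariant object by a subobject of an invariant object
embeds into an invariant object. -/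
lemma exists_mono_of_shortExact {S : ShortComplex C} (hS : S.ShortExact) {N T : C}
    [FiniteDimensional k (Ext.{w} T N 1)]
    (hT : Nonempty (F.functor.obj T ≅ T)) (hN : Nonempty (F.functor.obj N ≅ N))
    (m : S.X₁ ⟶ N) [Mono m] (i : S.X₃ ⟶ T) (p : T ⟶ S.X₃) (hip : i ≫ p = 𝟙 S.X₃) :
    ∃ (N' : C) (ι : S.X₂ ⟶ N'), Nonempty (F.functor.obj N' ≅ N') ∧ Mono ι := by
  obtain ⟨Z, f, _, ⟨ζ⟩, hZ⟩ := exists_mono_forall_comp_eq_zero.{w} (k := k) F hT hN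
  obtain ⟨τ⟩ := hT
  have hx := hZ _ (((isYonedaClass_extClass hS).postcomp m).precomp p)
  obtain ⟨h, hh⟩ := hS.exists_comp_eq_of_extClass_comp_eq_zero.{w} (m ≫ f) (by
    have := congrArg (fun y => (mk₀ i).comp y (zero_add 1)) hx
    simpa [mk₀_comp_mk₀_assoc, hip] using this)
  have : Mono i := mono_of_mono_fac hip
  have := preservesBinaryBiproducts_of_preservesBiproducts F.functor
  refine ⟨Z ⊞ T, biprod.lift h (S.g ≫ i), ⟨F.functor.mapBiprod Z T ≪≫ biprod.mapIso ζ τ⟩, ?_⟩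
  refine Preadditive.mono_of_cancel_zero _ fun {A} a ha => ?_
  have h₁ : a ≫ h = 0 := by simpa using ha =≫ biprod.fst
  have h₂ : a ≫ S.g = 0 := by
    rw [← cancel_mono i]
    simpa using ha =≫ biprod.snd
  have := hS.mono_f
  obtain ⟨l, hl⟩ : ∃ l, l ≫ S.f = a := ⟨hS.exact.lift a h₂, hS.exact.lift_f a h₂⟩
  have hl' : l ≫ m ≫ f = 0 := by rw [← hh, reassoc_of% hl, h₁]
  have : l = 0 := by
    rw [← cancel_mono (m ≫ f), hl', Limits.zero_comp]
  rw [← hl, this, Limits.zero_comp]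

end CategoryTheory.Abelian.Ext

section Subquotient

variable {S X Y : C}

lemma IsSubquotient.of_mono (h : IsSubquotient S X) (f : X ⟶ Y) [Mono f] :
    IsSubquotient S Y := by
  obtain ⟨A, a, q, _, hq⟩ := h
  exact ⟨A, a ≫ f, q, mono_comp a f, hq⟩

lemma IsSubquotient.of_epi (h : IsSubquotient X S) (g : X ⟶ Y) [Epi g] :
    IsSubquotient Y S := by
  obtain ⟨A, a, q, ha, _⟩ := h
  exact ⟨A, a, q ≫ g, ha, epi_comp q g⟩

lemma IsSubquotient.of_mono_left (h : IsSubquotient Y S) (f : X ⟶ Y) [Mono f] :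
    IsSubquotient X S := by
  obtain ⟨A, a, q, _, _⟩ := h
  exact ⟨pullback f q, pullback.snd f q ≫ a, pullback.fst f q, mono_comp _ _, inferInstance⟩

lemma IsSubquotient.map (h : IsSubquotient S X) (F : C ≌ C) :
    IsSubquotient (F.functor.obj S) (F.functor.obj X) := by
  obtain ⟨A, a, q, _, _⟩ := h
  exact ⟨F.functor.obj A, F.functor.map a, F.functor.map q, inferInstance, inferInstance⟩

/-- A simple subquotient of `Y` is a subquotient of a given subobject of `Y` or of the
corresponding quotient. -/
lemma IsSubquotient.or_cokernel [Simple S] (h : IsSubquotient S Y) (f : X ⟶ Y) [Mono f] :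
    IsSubquotient S X ∨ IsSubquotient S (cokernel f) := by
  obtain ⟨A, a, q, _, _⟩ := h
  by_cases hq : kernel.ι (a ≫ cokernel.π f) ≫ q = 0
  · refine .inr ⟨Abelian.coimage (a ≫ cokernel.π f), Abelian.factorThruCoimage _,
      cokernel.desc _ q hq, inferInstance, ?_⟩
    exact epi_of_epi_fac (cokernel.π_desc _ q hq)
  · have w : (kernel.ι (a ≫ cokernel.π f) ≫ a) ≫ cokernel.π f = 0 := by simp
    refine .inl ⟨_, Abelian.monoLift f _ w, kernel.ι (a ≫ cokernel.π f) ≫ q, ?_,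
      epi_of_nonzero_to_simple hq⟩
    exact mono_of_mono_fac (Abelian.monoLift_comp f _ w)

lemma IsSubquotient.nonempty_iso_of_simple [Simple S] [Simple X] (h : IsSubquotient S X) :
    Nonempty (S ≅ X) := by
  obtain ⟨A, a, q, _, _⟩ := h
  have hS : 𝟙 S ≠ 0 := id_nonzero S
  have : IsIso a := isIso_of_mono_of_nonzero fun ha => hS <| by
    have : 𝟙 A = 0 := by rw [← cancel_mono a, ha, comp_zero, comp_zero]
    rw [← cancel_epi q, Category.comp_id, comp_zero, ← Category.id_comp q, this, zero_comp]
  have : IsIso (inv a ≫ q) := isIso_of_epi_of_nonzero fun hq => hS <| by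
    rw [← cancel_epi (inv a ≫ q), hq, zero_comp, zero_comp]
  exact ⟨(asIso (inv a ≫ q)).symm⟩

lemma IsSubquotient.not_isZero [Simple S] (h : IsSubquotient S X) : ¬ IsZero X := by
  obtain ⟨A, a, q, _, _⟩ := h
  exact fun hX => Simple.not_isZero S ((hX.of_mono a).of_epi q)

end Subquotient

/-- Induction along a composition series. -/
lemma HasFiniteLength.induction {P : C → Prop} (zero : ∀ X, IsZero X → P X)
    (step : ∀ {X Y : C} (f : X ⟶ Y) [Mono f] [Simple (cokernel f)], P X → P Y)
    (iso : ∀ {X Y : C}, (X ≅ Y) → P X → P Y) {M : C} (hM : HasFiniteLength M) : P M := by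
  obtain ⟨m, X, f, h₀, hf, ⟨e⟩⟩ := hM
  refine iso e (Fin.induction (zero _ h₀) (fun i hi => ?_) (Fin.last m))
  have := (hf i).1
  have := (hf i).2
  exact step (f i) hi

lemma HasFiniteLength.exists_finite_simple_subquotients {M : C} (hM : HasFiniteLength M) :
    ∃ s : Set C, s.Finite ∧
      ∀ S : C, Simple S → IsSubquotient S M → ∃ T ∈ s, Nonempty (S ≅ T) := by
  refine hM.induction (P := fun M => ∃ s : Set C, s.Finite ∧
      ∀ S : C, Simple S → IsSubquotient S M → ∃ T ∈ s, Nonempty (S ≅ T))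
    (fun X hX => ⟨∅, Set.finite_empty, fun S _ h => (h.not_isZero hX).elim⟩) ?_ ?_
  · rintro X Y f _ _ ⟨s, hs, h⟩
    refine ⟨insert (cokernel f) s, hs.insert _, fun S _ hS => ?_⟩
    rcases hS.or_cokernel f with hS | hS
    · obtain ⟨T, hT, e⟩ := h S ‹_› hS
      exact ⟨T, Set.mem_insert_of_mem _ hT, e⟩
    · exact ⟨_, Set.mem_insert _ _, hS.nonempty_iso_of_simple⟩
  · rintro X Y e ⟨s, hs, h⟩
    exact ⟨s, hs, fun S _ hS => h S ‹_› (hS.of_mono e.inv)⟩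

section Periodic

variable (F : C ≌ C)

lemma nonempty_iso_funcPow_of_add {S : C} (d : ℕ) : ∀ a : ℕ,
    Nonempty ((funcPow F.functor a).obj S ≅ (funcPow F.functor (d + a)).obj S) →
      Nonempty (S ≅ (funcPow F.functor d).obj S)
  | 0, h => h
  | a + 1, ⟨e⟩ => nonempty_iso_funcPow_of_add d a ⟨F.functor.preimageIso e⟩

lemma simple_funcPow_obj (S : C) [Simple S] : ∀ j, Simple ((funcPow F.functor j).obj S)
  | 0 => ‹Simple S›
  | j + 1 =>
    have := simple_funcPow_obj S j
    simple_obj F.functor _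

lemma IsSubquotient.funcPow_obj {S X : C} (h : IsSubquotient S X) (e : F.functor.obj X ≅ X) :
    ∀ j, IsSubquotient ((funcPow F.functor j).obj S) X
  | 0 => h
  | j + 1 => ((h.funcPow_obj e j).map F).of_mono e.hom

/-- A simple subquotient of an invariant object of finite length is periodic. -/
lemma IsSubquotient.exists_nonempty_iso_funcPow {S X : C} [Simple S] (h : IsSubquotient S X)
    (hX : HasFiniteLength X) (e : F.functor.obj X ≅ X) :
    ∃ d : ℕ, Nonempty (S ≅ (funcPow F.functor (d + 1)).obj S) := by
  obtain ⟨s, hs, H⟩ := hX.exists_finite_simple_subquotients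
  choose T hT i using fun j => H _ (simple_funcPow_obj F S j) (h.funcPow_obj F e j)
  obtain ⟨a, b, hab, hT'⟩ := hs.exists_lt_map_eq_of_forall_mem hT
  obtain ⟨d, rfl⟩ := Nat.exists_eq_add_of_lt hab
  refine ⟨d, nonempty_iso_funcPow_of_add F (d + 1) a ?_⟩
  obtain ⟨u⟩ := i a
  obtain ⟨v⟩ := i (a + d + 1)
  rw [show d + 1 + a = a + d + 1 by ring]
  exact ⟨u ≪≫ eqToIso hT' ≪≫ v.symm⟩

attribute [local instance] Abelian.hasFiniteBiproducts

/-- A periodic object is a retract of an invariant object. -/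
lemma exists_invariant_retract [F.functor.Additive] {S : C} {d : ℕ}
    (e : S ≅ (funcPow F.functor (d + 1)).obj S) :
    ∃ (T : C) (i : S ⟶ T) (p : T ⟶ S), Nonempty (F.functor.obj T ≅ T) ∧ i ≫ p = 𝟙 S := by
  let G (j : Fin (d + 1)) : C := (funcPow F.functor j).obj S
  have w (j : Fin (d + 1)) : Nonempty (G (finRotate (d + 1) j) ≅ F.functor.obj (G j)) := by
    induction j using Fin.lastCases with
    | last =>
      rw [finRotate_last]
      exact ⟨e⟩
    | cast j =>
      rw [finRotate_apply, Fin.coeSucc_eq_succ]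
      exact ⟨Iso.refl _⟩
  refine ⟨⨁ G, biproduct.ι G 0, biproduct.π G 0, ⟨F.functor.mapBiproduct G ≪≫
    biproduct.whiskerEquiv (finRotate (d + 1)) fun j => (w j).some⟩, biproduct.ι_π_self G 0⟩

end Periodic

/-- In a `k`-linear abelian category in which every object has finite length and all
`Ext¹`-groups are finite-dimensional, if `M` is a subquotient of an object `Ñ` which is
invariant under a `k`-linear self-equivalence `F`, then `M` embeds into an `F`-invariant
object. -/
theorem embeds_into_invariant_of_subquotient_of_invariant
    {k : Type t} [Field k] [Linear k C] [HasExt.{w} C]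
    (hlen : ∀ M : C, HasFiniteLength M)
    (hext : ∀ X Y : C, FiniteDimensional k (Abelian.Ext Y X 1))
    (F : C ≌ C) [F.functor.Additive] [F.functor.Linear k]
    (M Ntilde : C) (hNtilde : Nonempty (F.functor.obj Ntilde ≅ Ntilde))
    (hM : IsSubquotient M Ntilde) :
    ∃ (N : C) (ι : M ⟶ N), Nonempty (F.functor.obj N ≅ N) ∧ Mono ι := by
  obtain ⟨e⟩ := hNtilde
  refine (hlen M).induction (P := fun M => IsSubquotient M Ntilde →
    ∃ (N : C) (ι : M ⟶ N), Nonempty (F.functor.obj N ≅ N) ∧ Mono ι) ?_ ?_ ?_ hM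
  · exact fun X hX _ => ⟨X, 𝟙 X, ⟨(F.functor.map_isZero hX).iso hX⟩, inferInstance⟩
  · intro X Y f _ _ ih hY
    obtain ⟨N, m, hN, _⟩ := ih (hY.of_mono_left f)
    obtain ⟨d, ⟨σ⟩⟩ := (hY.of_epi (cokernel.π f)).exists_nonempty_iso_funcPow F (hlen _) e
    obtain ⟨T, i, p, hT, hip⟩ := exists_invariant_retract F σ
    have hS : (ShortComplex.mk f (cokernel.π f) (cokernel.condition f)).ShortExact :=
      { exact := ShortComplex.exact_cokernel f }
    have := hext N T
    exact Abelian.Ext.exists_mono_of_shortExact.{w} (k := k) F hS hT hN m i p hip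
  · intro X Y u ih hY
    obtain ⟨N, m, hN, _⟩ := ih (hY.of_mono_left u.hom)
    exact ⟨N, u.inv ≫ m, hN, mono_comp _ _⟩
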